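/- arXiv:1805.09188 — 5 statements merged into one kernel-verified Lean document; each statement's English description precedes it below -/
import Mathlib

section
/- There exist absolute constants c₁, c₂, c₃, C > 0 such that for every N there exists an integer n ≥ N, a finite set A of positive rationals with c₁·n ≤ |A| ≤ c₂·n, and a set of edges E ⊆ A × A with |E| ≥ c₃ · n^{3/2}, such that |A +_E A| + |A /_E A| + |(A+1) /_E (A+1)| + |A −_E A| ≤ C·n. -/
/-- The graph-restricted sumset `A +_E A = {a + b : (a, b) ∈ E}`. -/
def sumE (E : Finset (ℚ × ℚ)) : Finset ℚ := E.image fun p => p.1 + p.2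

/-- The graph-restricted difference set `A −_E A = {a − b : (a, b) ∈ E}`. -/
def diffE (E : Finset (ℚ × ℚ)) : Finset ℚ := E.image fun p => p.1 - p.2

/-- The graph-restricted shifted ratio set
`(A + x) /_E (A + x) = {(a + x)/(b + x) : (a, b) ∈ E}`. -/
def ratioShiftE (E : Finset (ℚ × ℚ)) (x : ℚ) : Finset ℚ :=
  E.image fun p => (p.1 + x) / (p.2 + x)

open Finset

/-- The triples of integers in `[1, M]` with no common factor. -/
def primitiveTriples (M : ℕ) : Finset (ℕ × ℕ × ℕ) :=
  (Icc 1 M ×ˢ Icc 1 M ×ˢ Icc 1 M).filter fun t => t.1.gcd (t.2.1.gcd t.2.2) = 1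

/-- The affine point `(p / r, q / r)` with homogeneous coordinates `(p, q, r)`. -/
def affinePoint (t : ℕ × ℕ × ℕ) : ℚ × ℚ := ((t.1 : ℚ) / t.2.2, (t.2.1 : ℚ) / t.2.2)

theorem mem_primitiveTriples {M p q r : ℕ} :
    (p, q, r) ∈ primitiveTriples M ↔
      ((1 ≤ p ∧ p ≤ M) ∧ (1 ≤ q ∧ q ≤ M) ∧ (1 ≤ r ∧ r ≤ M)) ∧ p.gcd (q.gcd r) = 1 := by
  simp [primitiveTriples]

theorem sum_Icc_two_inv_cube_le (M : ℕ) (hM : 1 ≤ M) :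
    ∑ d ∈ Icc 2 M, 1 / (d : ℝ) ^ 3 ≤ 1 / 2 * (1 - 1 / (M : ℝ)) := by
  induction M, hM using Nat.le_induction with
  | base => simp
  | succ k hk ih =>
    rw [sum_Icc_succ_top (by omega)]
    have hk1 : (1 : ℝ) ≤ k := by exact_mod_cast hk
    have key : 1 / ((k + 1 : ℕ) : ℝ) ^ 3 ≤ 1 / 2 * (1 / (k : ℝ) - 1 / ((k + 1 : ℕ) : ℝ)) := by
      push_cast
      have h : 1 / 2 * (1 / (k : ℝ) - 1 / (k + 1)) = 1 / (2 * (k * (k + 1))) := by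
        field_simp
        ring
      rw [h]
      apply one_div_le_one_div_of_le (by positivity)
      nlinarith [pow_pos (by linarith : (0 : ℝ) < k) 3]
    linarith

theorem cube_le_card_primitiveTriples_add_sum (M : ℕ) :
    M ^ 3 ≤ (primitiveTriples M).card + ∑ d ∈ Icc 2 M, (M / d) ^ 3 := by
  let multiples (d : ℕ) : Finset (ℕ × ℕ × ℕ) :=
    (Icc 1 (M / d) ×ˢ Icc 1 (M / d) ×ˢ Icc 1 (M / d)).image
      fun t => (d * t.1, d * t.2.1, d * t.2.2)
  have hcover : Icc 1 M ×ˢ Icc 1 M ×ˢ Icc 1 M ⊆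
      primitiveTriples M ∪ (Icc 2 M).biUnion multiples := by
    rintro ⟨p, q, r⟩ h
    simp only [mem_product, mem_Icc] at h
    obtain ⟨hp, hq, hr⟩ := h
    rw [mem_union]
    by_cases hg : p.gcd (q.gcd r) = 1
    · exact Or.inl (mem_primitiveTriples.2 ⟨⟨hp, hq, hr⟩, hg⟩)
    · right
      set d := p.gcd (q.gcd r) with hd
      have hdpos : 0 < d := Nat.gcd_pos_of_pos_left _ (by omega)
      have hdp : d ∣ p := Nat.gcd_dvd_left _ _
      have hdq : d ∣ q := (Nat.gcd_dvd_right _ _).trans (Nat.gcd_dvd_left _ _)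
      have hdr : d ∣ r := (Nat.gcd_dvd_right _ _).trans (Nat.gcd_dvd_right _ _)
      have hquot : ∀ {x : ℕ}, d ∣ x → 1 ≤ x ∧ x ≤ M → 1 ≤ x / d ∧ x / d ≤ M / d :=
        fun hdx hx => ⟨Nat.div_pos (Nat.le_of_dvd (by omega) hdx) hdpos,
          Nat.div_le_div_right hx.2⟩
      have hdM : d ≤ M := (Nat.le_of_dvd (by omega) hdp).trans hp.2
      simp only [mem_biUnion, mem_Icc, multiples, mem_image, mem_product]
      exact ⟨d, ⟨by omega, hdM⟩, (p / d, q / d, r / d),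
        ⟨hquot hdp hp, hquot hdq hq, hquot hdr hr⟩,
        by simp only [Nat.mul_div_cancel' hdp, Nat.mul_div_cancel' hdq, Nat.mul_div_cancel' hdr]⟩
  calc M ^ 3 = (Icc 1 M ×ˢ Icc 1 M ×ˢ Icc 1 M).card := by simp; ring
    _ ≤ _ := card_le_card hcover
    _ ≤ _ := card_union_le _ _
    _ ≤ _ := by
      gcongr
      refine card_biUnion_le.trans (sum_le_sum fun d _ => card_image_le.trans ?_)
      simp only [card_product, Nat.card_Icc, Nat.add_sub_cancel]
      exact le_of_eq (by ring)

theorem half_cube_le_card_primitiveTriples {M : ℕ} (hM : 1 ≤ M) :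
    1 / 2 * (M : ℝ) ^ 3 ≤ (primitiveTriples M).card := by
  have h : (M : ℝ) ^ 3 ≤ (primitiveTriples M).card + ∑ d ∈ Icc 2 M, ((M / d : ℕ) : ℝ) ^ 3 := by
    exact_mod_cast cube_le_card_primitiveTriples_add_sum M
  have hsum : ∑ d ∈ Icc 2 M, ((M / d : ℕ) : ℝ) ^ 3 ≤ (M : ℝ) ^ 3 * (1 / 2) := by
    calc ∑ d ∈ Icc 2 M, ((M / d : ℕ) : ℝ) ^ 3
        ≤ ∑ d ∈ Icc 2 M, (M : ℝ) ^ 3 * (1 / (d : ℝ) ^ 3) := by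
          refine sum_le_sum fun d _ => ?_
          rw [mul_one_div, ← div_pow]
          exact pow_le_pow_left₀ (by positivity) Nat.cast_div_le 3
      _ = (M : ℝ) ^ 3 * ∑ d ∈ Icc 2 M, 1 / (d : ℝ) ^ 3 := (mul_sum _ _ _).symm
      _ ≤ (M : ℝ) ^ 3 * (1 / 2) := by
          gcongr
          have : (0 : ℝ) ≤ 1 / M := by positivity
          linarith [sum_Icc_two_inv_cube_le M hM]
  linarith

theorem dvd_of_proportional {p q r p' q' r' : ℕ} (hg : p.gcd (q.gcd r) = 1)
    (hp : p * r' = p' * r) (hq : q * r' = q' * r) : r ∣ r' := by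
  have h : r ∣ (p * r').gcd ((q * r').gcd (r * r')) :=
    Nat.dvd_gcd (hp ▸ dvd_mul_left _ _) (Nat.dvd_gcd (hq ▸ dvd_mul_left _ _) (dvd_mul_right _ _))
  rwa [Nat.gcd_mul_right, Nat.gcd_mul_right, hg, one_mul] at h

theorem injOn_affinePoint (M : ℕ) : Set.InjOn affinePoint (primitiveTriples M) := by
  rintro ⟨p, q, r⟩ h ⟨p', q', r'⟩ h' heq
  rw [mem_coe, mem_primitiveTriples] at h h'
  obtain ⟨⟨-, -, hr, -⟩, hg⟩ := h
  obtain ⟨⟨-, -, hr', -⟩, hg'⟩ := h'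
  have hr0 : (r : ℚ) ≠ 0 := by positivity
  have hr0' : (r' : ℚ) ≠ 0 := by positivity
  simp only [affinePoint, Prod.mk.injEq, div_eq_div_iff hr0 hr0'] at heq
  obtain ⟨hp, hq⟩ := heq
  norm_cast at hp hq
  have hrr : r = r' := Nat.dvd_antisymm (dvd_of_proportional hg hp hq)
    (dvd_of_proportional hg' hp.symm hq.symm)
  subst hrr
  rw [Nat.mul_left_inj (by omega)] at hp hq
  rw [hp, hq]

theorem card_image_affinePoint_le {M : ℕ} (f : ℚ × ℚ → ℚ) (S T : Finset ℤ)
    (h : ∀ p q r : ℕ, 1 ≤ p → p ≤ M → 1 ≤ q → q ≤ M → 1 ≤ r → r ≤ M →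
      ∃ s ∈ S, ∃ t ∈ T, (s : ℚ) / t = f (p / r, q / r)) :
    (((primitiveTriples M).image affinePoint).image f).card ≤ S.card * T.card := by
  rw [← card_product]
  refine (card_le_card ?_).trans (card_image_le (f := fun x : ℤ × ℤ => (x.1 : ℚ) / x.2))
  intro y hy
  simp only [mem_image] at hy
  obtain ⟨_, ⟨⟨p, q, r⟩, ht, rfl⟩, rfl⟩ := hy
  rw [mem_primitiveTriples] at ht
  obtain ⟨⟨hp, hq, hr⟩, -⟩ := ht
  obtain ⟨s, hs, t, ht, hst⟩ := h p q r hp.1 hp.2 hq.1 hq.2 hr.1 hr.2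
  exact mem_image.2 ⟨(s, t), mem_product.2 ⟨hs, ht⟩, hst⟩

theorem four_restricted_sets_construction :
    ∃ c₁ c₂ c₃ C : ℝ, 0 < c₁ ∧ 0 < c₂ ∧ 0 < c₃ ∧ 0 < C ∧ ∀ N : ℕ, ∃ n : ℕ, N ≤ n ∧
      ∃ (A : Finset ℚ) (E : Finset (ℚ × ℚ)),
        (∀ a ∈ A, 0 < a) ∧ E ⊆ A ×ˢ A ∧
        c₁ * (n : ℝ) ≤ (A.card : ℝ) ∧ (A.card : ℝ) ≤ c₂ * (n : ℝ) ∧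
        c₃ * (n : ℝ) ^ ((3 : ℝ) / 2) ≤ (E.card : ℝ) ∧
        (((sumE E).card + (ratioShiftE E 0).card + (ratioShiftE E 1).card
          + (diffE E).card : ℕ) : ℝ) ≤ C * (n : ℝ) := by
  refine ⟨1, 2, 1 / 2, 10, one_pos, two_pos, by norm_num, by norm_num, fun N => ?_⟩
  obtain ⟨M, hM, hNM⟩ : ∃ M : ℕ, 1 ≤ M ∧ N ≤ M := ⟨N + 1, by omega, by omega⟩
  let fractions : Finset ℚ :=
    (Icc 1 M ×ˢ Icc 1 M).image fun x : ℕ × ℕ => (x.1 : ℚ) / x.2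
  let integers : Finset ℚ := (Icc 1 (M ^ 2)).image fun k : ℕ => (k : ℚ)
  have hfractions : fractions.card ≤ M ^ 2 :=
    card_image_le.trans (by simp [sq])
  have hintegers : integers.card = M ^ 2 := by
    rw [card_image_of_injective _ Nat.cast_injective, Nat.card_Icc, Nat.add_sub_cancel]
  refine ⟨M ^ 2, by nlinarith, fractions ∪ integers, (primitiveTriples M).image affinePoint,
    ?_, ?_, ?_, ?_, ?_, ?_⟩
  · intro a ha
    simp only [fractions, integers, mem_union, mem_image, mem_product, mem_Icc] at ha
    obtain ⟨⟨p, r⟩, ⟨⟨hp, -⟩, hr, -⟩, rfl⟩ | ⟨k, ⟨hk, -⟩, rfl⟩ := ha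
    · dsimp only at hp hr ⊢
      positivity
    · positivity
  · intro x hx
    obtain ⟨⟨p, q, r⟩, ht, rfl⟩ := mem_image.1 hx
    rw [mem_primitiveTriples] at ht
    obtain ⟨⟨hp, hq, hr⟩, -⟩ := ht
    have hmem : ∀ k : ℕ, 1 ≤ k ∧ k ≤ M → (k : ℚ) / r ∈ fractions ∪ integers := fun k hk =>
      mem_union_left _ (mem_image.2 ⟨(k, r), by simp [hk, hr], rfl⟩)
    exact mem_product.2 ⟨hmem p hp, hmem q hq⟩
  · rw [one_mul]
    exact_mod_cast hintegers ▸ card_le_card subset_union_right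
  · have h := card_union_le fractions integers
    exact_mod_cast (by omega : (fractions ∪ integers).card ≤ 2 * M ^ 2)
  · rw [card_image_of_injOn (injOn_affinePoint M)]
    convert half_cube_le_card_primitiveTriples hM using 2
    rw [Nat.cast_pow, ← Real.rpow_natCast (M : ℝ) 2, ← Real.rpow_mul (by positivity),
      ← Real.rpow_natCast (M : ℝ) 3]
    norm_num
  · have hsum : (sumE ((primitiveTriples M).image affinePoint)).card ≤ 2 * M * M := by
      refine (card_image_affinePoint_le _ (Icc 1 (2 * M)) (Icc 1 M) ?_).trans
        (by simp [Int.card_Icc]; norm_cast)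
      intro p q r _ _ _ _ _ _
      exact ⟨p + q, by simp only [mem_Icc]; omega, r, by simp only [mem_Icc]; omega,
        by push_cast; exact add_div _ _ _⟩
    have hdiff : (diffE ((primitiveTriples M).image affinePoint)).card ≤ 2 * M * M := by
      refine (card_image_affinePoint_le _ (Icc (1 - M) M) (Icc 1 M) ?_).trans
        (Nat.mul_le_mul (by rw [Int.card_Icc]; omega) (by simp [Int.card_Icc]))
      intro p q r _ _ _ _ _ _
      exact ⟨p - q, by simp only [mem_Icc]; omega, r, by simp only [mem_Icc]; omega,
        by push_cast; exact sub_div _ _ _⟩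
    have hratio : (ratioShiftE ((primitiveTriples M).image affinePoint) 0).card ≤ M * M := by
      refine (card_image_affinePoint_le _ (Icc 1 M) (Icc 1 M) ?_).trans
        (by simp [Int.card_Icc])
      intro p q r _ _ _ _ _ _
      refine ⟨p, by simp only [mem_Icc]; omega, q, by simp only [mem_Icc]; omega, ?_⟩
      have : (r : ℚ) ≠ 0 := by positivity
      simp only [add_zero, Int.cast_natCast]
      rw [div_div_div_cancel_right₀ this]
    have hshift :
        (ratioShiftE ((primitiveTriples M).image affinePoint) 1).card ≤ 2 * M * (2 * M) := by
      refine (card_image_affinePoint_le _ (Icc 1 (2 * M)) (Icc 1 (2 * M)) ?_).trans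
        (Nat.mul_le_mul (by rw [Int.card_Icc]; omega) (by rw [Int.card_Icc]; omega))
      intro p q r _ _ _ _ _ _
      refine ⟨p + r, by simp only [mem_Icc]; omega, q + r, by simp only [mem_Icc]; omega, ?_⟩
      have : (r : ℚ) ≠ 0 := by positivity
      push_cast
      rw [div_add_one this, div_add_one this, div_div_div_cancel_right₀ this]
    exact_mod_cast (by nlinarith : _ ≤ 10 * M ^ 2)
end

section
/- There exist absolute constants c₁, c₂, c₃, C > 0 such that for every N there exists an integer n ≥ N, a finite set A ⊆ ℝ of nonzero reals with c₁·n ≤ |A| ≤ c₂·n, and a set S ⊆ A × A with |S| ≥ c₃ · n^{3/2}, such that |A +_S A| + |A /_S A| ≤ C·n. -/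
/-- The graph-restricted sumset `A +_S A = {a + b : (a, b) ∈ S}`. -/
noncomputable def sumS (S : Finset (ℝ × ℝ)) : Finset ℝ := S.image fun p => p.1 + p.2

/-- The graph-restricted ratio set `A /_S A = {a / b : (a, b) ∈ S}`. -/
noncomputable def ratioS (S : Finset (ℝ × ℝ)) : Finset ℝ := S.image fun p => p.1 / p.2

/-- A number `M ^ i * p` with `0 < p < M` determines both the exponent `i` and the digit `p`. -/
theorem pow_mul_digit_injective {M i j p q : ℕ} (hp : 0 < p) (hpM : p < M) (hq : 0 < q)
    (hqM : q < M) (h : M ^ i * p = M ^ j * q) : i = j ∧ p = q := by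
  have log_eq : ∀ {i p : ℕ}, 0 < p → p < M → Nat.log M (M ^ i * p) = i := by
    intro i p hp hpM
    refine Nat.log_eq_of_pow_le_of_lt_pow (Nat.le_mul_of_pos_right _ hp) ?_
    rw [pow_succ]
    exact Nat.mul_lt_mul_of_pos_left hpM (pow_pos (by omega) _)
  have hij : i = j := by rw [← log_eq (i := i) hp hpM, h, log_eq hq hqM]
  subst hij
  exact ⟨rfl, Nat.eq_of_mul_eq_mul_left (pow_pos (by omega) i) h⟩

theorem alon_ruzsa_solymosi_construction :
    ∃ c₁ c₂ c₃ C : ℝ, 0 < c₁ ∧ 0 < c₂ ∧ 0 < c₃ ∧ 0 < C ∧ ∀ N : ℕ, ∃ n : ℕ, N ≤ n ∧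
      ∃ (A : Finset ℝ) (S : Finset (ℝ × ℝ)),
        (0 : ℝ) ∉ A ∧ S ⊆ A ×ˢ A ∧
        c₁ * (n : ℝ) ≤ (A.card : ℝ) ∧ (A.card : ℝ) ≤ c₂ * (n : ℝ) ∧
        c₃ * (n : ℝ) ^ ((3 : ℝ) / 2) ≤ (S.card : ℝ) ∧
        (((sumS S).card + (ratioS S).card : ℕ) : ℝ) ≤ C * (n : ℝ) := by
  refine ⟨1, 1, 1, 3, one_pos, one_pos, one_pos, three_pos, fun k => ⟨k ^ 2, ?_, ?_⟩⟩
  · exact Nat.le_self_pow two_ne_zero k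
  let f : ℕ × ℕ → ℝ := fun x => (((k + 1) ^ x.1 * x.2 : ℕ) : ℝ)
  let D := Finset.range k ×ˢ Finset.Icc 1 k
  let E := Finset.range k ×ˢ (Finset.Icc 1 k ×ˢ Finset.Icc 1 k)
  let g : ℕ × ℕ × ℕ → ℝ × ℝ := fun x => (f (x.1, x.2.1), f (x.1, x.2.2))
  have hf : Set.InjOn f D := by
    rintro ⟨i, p⟩ hx ⟨j, q⟩ hy h
    simp only [D, Finset.coe_product, Set.mem_prod, Finset.mem_coe, Finset.mem_Icc] at hx hy
    obtain ⟨h1, h2⟩ := pow_mul_digit_injective (by omega) (by omega) (by omega) (by omega)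
      (Nat.cast_injective (R := ℝ) h)
    exact Prod.ext h1 h2
  have hg : Set.InjOn g E := by
    rintro ⟨i, p, q⟩ hx ⟨j, r, s⟩ hy h
    simp only [E, Finset.mem_coe, Finset.mem_product] at hx hy
    obtain ⟨h1, h2⟩ := Prod.mk.inj h
    have e1 := hf (by simpa [D] using ⟨by simpa using hx.1, by simpa using hx.2.1⟩)
      (by simpa [D] using ⟨by simpa using hy.1, by simpa using hy.2.1⟩) h1
    have e2 := hf (by simpa [D] using ⟨by simpa using hx.1, by simpa using hx.2.2⟩)
      (by simpa [D] using ⟨by simpa using hy.1, by simpa using hy.2.2⟩) h2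
    simp only [Prod.mk.injEq] at e1 e2 ⊢
    exact ⟨e1.1, e1.2, e2.2⟩
  have hA : (D.image f).card = k ^ 2 := by
    rw [Finset.card_image_of_injOn hf]
    simp [D, sq]
  have hS : (E.image g).card = k ^ 3 := by
    rw [Finset.card_image_of_injOn hg]
    simp [E]
    ring
  have hsum : (sumS (E.image g)).card ≤ 2 * k ^ 2 := by
    have hsub : sumS (E.image g) ⊆ (Finset.range k ×ˢ Finset.Icc 1 (2 * k)).image f := by
      intro y hy
      simp only [sumS, Finset.mem_image, exists_exists_and_eq_and] at hy
      obtain ⟨⟨i, p, q⟩, hx, rfl⟩ := hy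
      simp only [E, Finset.mem_product, Finset.mem_Icc] at hx
      refine Finset.mem_image.2 ⟨(i, p + q), ?_, ?_⟩
      · simp only [Finset.mem_product, Finset.mem_Icc]
        exact ⟨hx.1, by omega, by omega⟩
      · simp only [f, g]
        push_cast
        ring
    refine (Finset.card_le_card hsub).trans (Finset.card_image_le.trans (le_of_eq ?_))
    simp
    ring
  have hratio : (ratioS (E.image g)).card ≤ k ^ 2 := by
    have hsub : ratioS (E.image g) ⊆
        (Finset.Icc 1 k ×ˢ Finset.Icc 1 k).image fun x : ℕ × ℕ => (x.1 : ℝ) / x.2 := by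
      intro y hy
      simp only [ratioS, Finset.mem_image, exists_exists_and_eq_and] at hy
      obtain ⟨⟨i, p, q⟩, hx, rfl⟩ := hy
      refine Finset.mem_image.2 ⟨(p, q), (Finset.mem_product.1 hx).2, ?_⟩
      simp only [f, g]
      push_cast
      rw [mul_div_mul_left _ _ (by positivity)]
    refine (Finset.card_le_card hsub).trans (Finset.card_image_le.trans (le_of_eq ?_))
    simp [sq]
  refine ⟨D.image f, E.image g, ?_, ?_, ?_, ?_, ?_, ?_⟩
  · intro h
    obtain ⟨⟨i, p⟩, hx, h0⟩ := Finset.mem_image.1 h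
    simp only [D, Finset.mem_product, Finset.mem_Icc] at hx
    have : 0 < (k + 1) ^ i * p := Nat.mul_pos (by positivity) (by omega)
    exact this.ne' (Nat.cast_eq_zero.1 h0)
  · intro y hy
    obtain ⟨⟨i, p, q⟩, hx, rfl⟩ := Finset.mem_image.1 hy
    simp only [E, Finset.mem_product] at hx
    exact Finset.mem_product.2
      ⟨Finset.mem_image_of_mem f (Finset.mem_product.2 ⟨hx.1, hx.2.1⟩),
        Finset.mem_image_of_mem f (Finset.mem_product.2 ⟨hx.1, hx.2.2⟩)⟩
  · rw [hA, one_mul]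
  · rw [hA, one_mul]
  · rw [hS, one_mul]
    push_cast
    rw [← Real.rpow_natCast_mul (Nat.cast_nonneg k), ← Real.rpow_natCast]
    norm_num
  · have : (sumS (E.image g)).card + (ratioS (E.image g)).card ≤ 3 * k ^ 2 := by omega
    exact_mod_cast this
end

section
/- Let n be a positive integer, let m = ⌊√n⌋, let A = {i/j ∈ ℚ : 1 ≤ i, j ≤ m, gcd(i,j) = 1}, and let E = {(i/j, k/j) : 1 ≤ i, j, k ≤ m, gcd(i,j) = 1, gcd(k,j) = 1} ⊆ A × A (where i/j and k/j are in lowest terms). Then for all positive integers x and y, the shifted graph-restricted ratio set satisfies |(A+x) /_E (A+y)| ≤ (1+x)·(1+y)·n, where (A+x) /_E (A+y) := {(a+x)/(b+y) : (a,b) ∈ E}. -/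
theorem shifted_ratio_set_of_coprime_construction_bound
    (n : ℕ) (hn : 0 < n) (x y : ℕ) (hx : 0 < x) (hy : 0 < y) :
    let m := Nat.sqrt n
    -- the set A = {i/j : 1 ≤ i, j ≤ m, gcd(i,j) = 1}
    let A : Finset ℚ :=
      ((Finset.Icc 1 m ×ˢ Finset.Icc 1 m).filter fun p => Nat.gcd p.1 p.2 = 1).image
        fun p => (p.1 : ℚ) / (p.2 : ℚ)
    -- the edge set E = {(i/j, k/j) : 1 ≤ i, j, k ≤ m, gcd(i,j) = 1, gcd(k,j) = 1}
    let E : Finset (ℚ × ℚ) :=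
      ((Finset.Icc 1 m ×ˢ Finset.Icc 1 m ×ˢ Finset.Icc 1 m).filter
        fun t => Nat.gcd t.1 t.2.1 = 1 ∧ Nat.gcd t.2.2 t.2.1 = 1).image
        fun t => ((t.1 : ℚ) / (t.2.1 : ℚ), (t.2.2 : ℚ) / (t.2.1 : ℚ))
    E ⊆ A ×ˢ A ∧
      (((E.image fun p => (p.1 + (x : ℚ)) / (p.2 + (y : ℚ))).card : ℕ) : ℝ)
        ≤ (1 + (x : ℝ)) * (1 + (y : ℝ)) * (n : ℝ) := by
  intro m A E
  refine ⟨?_, ?_⟩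
  · rintro _ h
    obtain ⟨⟨i, j, k⟩, ht, rfl⟩ := Finset.mem_image.1 h
    simp only [Finset.mem_filter, Finset.mem_product] at ht
    obtain ⟨⟨hi, hj, hk⟩, hij, hkj⟩ := ht
    exact Finset.mem_product.2
      ⟨Finset.mem_image.2 ⟨(i, j), by simp only [Finset.mem_filter, Finset.mem_product]; tauto, rfl⟩,
        Finset.mem_image.2 ⟨(k, j), by simp only [Finset.mem_filter, Finset.mem_product]; tauto, rfl⟩⟩
  · have hsub : (E.image fun p => (p.1 + (x : ℚ)) / (p.2 + (y : ℚ))) ⊆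
        (Finset.Icc 1 ((1 + x) * m) ×ˢ Finset.Icc 1 ((1 + y) * m)).image
          fun p => (p.1 : ℚ) / (p.2 : ℚ) := by
      rintro _ h
      obtain ⟨_, hE, rfl⟩ := Finset.mem_image.1 h
      obtain ⟨⟨i, j, k⟩, ht, rfl⟩ := Finset.mem_image.1 hE
      simp only [Finset.mem_filter, Finset.mem_product, Finset.mem_Icc] at ht
      obtain ⟨⟨hi, hj, hk⟩, -⟩ := ht
      refine Finset.mem_image.2 ⟨(i + x * j, k + y * j), ?_, ?_⟩
      · simp only [Finset.mem_product, Finset.mem_Icc]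
        have hxj := Nat.mul_le_mul_left x hj.2
        have hyj := Nat.mul_le_mul_left y hj.2
        refine ⟨⟨by omega, by linarith⟩, ⟨by omega, by linarith⟩⟩
      · have hj0 : (j : ℚ) ≠ 0 := by exact_mod_cast (by omega : j ≠ 0)
        push_cast
        rw [← mul_div_mul_right ((i : ℚ) / j + x) _ hj0, add_mul, add_mul,
          div_mul_cancel₀ _ hj0, div_mul_cancel₀ _ hj0]
    have hcard := (Finset.card_le_card hsub).trans Finset.card_image_le
    rw [Finset.card_product, Nat.card_Icc, Nat.card_Icc, Nat.add_sub_cancel,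
      Nat.add_sub_cancel] at hcard
    have hbound : (1 + x) * m * ((1 + y) * m) ≤ (1 + x) * (1 + y) * n := by
      rw [mul_mul_mul_comm]
      exact Nat.mul_le_mul_left _ (Nat.sqrt_le n)
    exact_mod_cast hcard.trans hbound
end

section
/- There is an absolute constant c > 0 such that for every positive integer n there exist three n-pencils in the real projective plane, whose three centres are pairwise distinct and not collinear, which determine at least c · n² 3-rich points. -/
/-- A point of the real projective plane: a 1-dimensional linear subspace of `ℝ³`. -/
def IsProjPoint (p : Submodule ℝ (Fin 3 → ℝ)) : Prop := Module.finrank ℝ p = 1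

/-- A line of the real projective plane: a 2-dimensional linear subspace of `ℝ³`. -/
def IsProjLine (l : Submodule ℝ (Fin 3 → ℝ)) : Prop := Module.finrank ℝ l = 2

/-- An `n`-pencil with centre `p`: a set of `n` distinct projective lines all through `p`. -/
def IsPencil (n : ℕ) (p : Submodule ℝ (Fin 3 → ℝ))
    (L : Finset (Submodule ℝ (Fin 3 → ℝ))) : Prop :=
  IsProjPoint p ∧ L.card = n ∧ ∀ l ∈ L, IsProjLine l ∧ p ≤ l

/-- The set of 3-rich points of three pencils: points lying on one line from each pencil. -/
def RichPoints3 (L₁ L₂ L₃ : Finset (Submodule ℝ (Fin 3 → ℝ))) :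
    Set (Submodule ℝ (Fin 3 → ℝ)) :=
  {q | IsProjPoint q ∧ (∃ l ∈ L₁, q ≤ l) ∧ (∃ l ∈ L₂, q ≤ l) ∧ (∃ l ∈ L₃, q ≤ l)}

/-- The projective line with homogeneous equation `a ⬝ᵥ x = 0`. -/
noncomputable def dualLine (a : Fin 3 → ℝ) : Submodule ℝ (Fin 3 → ℝ) :=
  LinearMap.ker (dotProductEquiv ℝ (Fin 3) a)

theorem mem_dualLine {a x : Fin 3 → ℝ} :
    x ∈ dualLine a ↔ a 0 * x 0 + a 1 * x 1 + a 2 * x 2 = 0 := by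
  simp [dualLine, dotProduct, Fin.sum_univ_three]

theorem isProjLine_dualLine {a : Fin 3 → ℝ} (ha : a ≠ 0) : IsProjLine (dualLine a) := by
  have h := Module.Dual.finrank_ker_add_one_of_ne_zero
    (f := dotProductEquiv ℝ (Fin 3) a) (by simpa using ha)
  rw [Module.finrank_fin_fun] at h
  unfold IsProjLine dualLine
  omega

theorem isProjPoint_span_singleton {v : Fin 3 → ℝ} (hv : v ≠ 0) :
    IsProjPoint (Submodule.span ℝ {v}) :=
  finrank_span_singleton hv

theorem isPencil_image_dualLine {n : ℕ} {v : Fin 3 → ℝ} (hv : v ≠ 0) (a : ℕ → Fin 3 → ℝ)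
    (ha : ∀ i, a i ≠ 0) (hav : ∀ i, v ∈ dualLine (a i))
    (hinj : Function.Injective fun i => dualLine (a i)) [DecidableEq (Submodule ℝ (Fin 3 → ℝ))] :
    IsPencil n (Submodule.span ℝ {v}) ((Finset.range n).image fun i => dualLine (a i)) := by
  refine ⟨isProjPoint_span_singleton hv, ?_, ?_⟩
  · rw [Finset.card_image_of_injective _ hinj, Finset.card_range]
  · intro l hl
    obtain ⟨i, -, rfl⟩ := Finset.mem_image.1 hl
    exact ⟨isProjLine_dualLine (ha i), (Submodule.span_singleton_le_iff_mem _ _).2 (hav i)⟩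

theorem two_pow_real_injective : Function.Injective fun i : ℕ => (2 : ℝ) ^ i :=
  pow_right_injective₀ (by norm_num) (by norm_num)

theorem span_affine_point_inj {x y x' y' : ℝ}
    (h : Submodule.span ℝ {![x, y, 1]} = Submodule.span ℝ {![x', y', 1]}) :
    x = x' ∧ y = y' := by
  have hmem : ![x, y, 1] ∈ Submodule.span ℝ {![x', y', 1]} :=
    h ▸ Submodule.mem_span_singleton_self _
  obtain ⟨c, hc⟩ := Submodule.mem_span_singleton.1 hmem
  have h0 := congrFun hc 0
  have h1 := congrFun hc 1
  have h2 := congrFun hc 2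
  simp at h0 h1 h2
  subst h2
  constructor <;> linarith

theorem eq_span_affine_point {q : Submodule ℝ (Fin 3 → ℝ)} (hq : IsProjPoint q) {x y : ℝ}
    (hx : q ≤ dualLine ![1, 0, -x]) (hy : q ≤ dualLine ![0, 1, -y]) :
    q = Submodule.span ℝ {![x, y, 1]} := by
  refine Submodule.eq_of_le_of_finrank_eq (fun v hv => ?_) ?_
  · have h0 := mem_dualLine.1 (hx hv)
    have h1 := mem_dualLine.1 (hy hv)
    simp at h0 h1
    refine Submodule.mem_span_singleton.2 ⟨v 2, ?_⟩
    ext i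
    fin_cases i <;> simp <;> linarith
  · have hv : (![x, y, 1] : Fin 3 → ℝ) ≠ 0 := fun h => by simpa using congrFun h 2
    exact Eq.trans hq (finrank_span_singleton hv).symm

theorem not_exists_projLine_through_basis :
    ¬ ∃ l, IsProjLine l ∧ Submodule.span ℝ {(![0, 1, 0] : Fin 3 → ℝ)} ≤ l ∧
      Submodule.span ℝ {(![1, 0, 0] : Fin 3 → ℝ)} ≤ l ∧
      Submodule.span ℝ {(![0, 0, 1] : Fin 3 → ℝ)} ≤ l := by
  rintro ⟨l, hl, h1, h2, h3⟩
  rw [Submodule.span_singleton_le_iff_mem] at h1 h2 h3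
  have htop : l = ⊤ := by
    refine eq_top_iff.2 fun v _ => ?_
    have hv : v = v 1 • ![0, 1, 0] + v 0 • ![1, 0, 0] + v 2 • ![0, 0, 1] := by
      ext i
      fin_cases i <;> simp
    rw [hv]
    exact l.add_mem (l.add_mem (l.smul_mem _ h1) (l.smul_mem _ h2)) (l.smul_mem _ h3)
  rw [IsProjLine, htop, finrank_top, Module.finrank_fin_fun] at hl
  omega

theorem span_singleton_ne_of_notMem {v w : Fin 3 → ℝ} {a : Fin 3 → ℝ}
    (hw : w ∈ dualLine a) (hv : v ∉ dualLine a) :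
    Submodule.span ℝ {v} ≠ Submodule.span ℝ {w} := fun h =>
  hv ((Submodule.span_singleton_le_iff_mem _ _).2 hw (h ▸ Submodule.mem_span_singleton_self v))

theorem three_rich_points_quadratic_lower_bound :
    ∃ c : ℝ, 0 < c ∧ ∀ n : ℕ, 0 < n →
      ∃ (p₁ p₂ p₃ : Submodule ℝ (Fin 3 → ℝ))
        (L₁ L₂ L₃ : Finset (Submodule ℝ (Fin 3 → ℝ))),
        IsPencil n p₁ L₁ ∧ IsPencil n p₂ L₂ ∧ IsPencil n p₃ L₃ ∧
        p₁ ≠ p₂ ∧ p₁ ≠ p₃ ∧ p₂ ≠ p₃ ∧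
        (¬ ∃ l, IsProjLine l ∧ p₁ ≤ l ∧ p₂ ≤ l ∧ p₃ ≤ l) ∧
        c * (n : ℝ) ^ 2 ≤ ((RichPoints3 L₁ L₂ L₃).ncard : ℝ) := by
  classical
  refine ⟨1 / 4, by norm_num, fun n _ => ?_⟩
  refine ⟨Submodule.span ℝ {![0, 1, 0]}, Submodule.span ℝ {![1, 0, 0]},
    Submodule.span ℝ {![0, 0, 1]},
    (Finset.range n).image fun i => dualLine ![1, 0, -2 ^ i],
    (Finset.range n).image fun i => dualLine ![0, 1, -2 ^ i],
    (Finset.range n).image fun i => dualLine ![-2 ^ i, 1, 0], ?_, ?_, ?_, ?_, ?_, ?_,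
    not_exists_projLine_through_basis, ?_⟩
  · refine isPencil_image_dualLine (fun h => by simpa using congrFun h 1) _
      (fun i h => by simpa using congrFun h 0) (fun i => by simp [mem_dualLine]) ?_
    intro i j (h : dualLine _ = dualLine _)
    have hm : ![2 ^ i, 0, 1] ∈ dualLine ![1, 0, -2 ^ j] := h ▸ by simp [mem_dualLine]
    simp [mem_dualLine] at hm
    exact two_pow_real_injective (by simp only; linarith)
  · refine isPencil_image_dualLine (fun h => by simpa using congrFun h 0) _
      (fun i h => by simpa using congrFun h 1) (fun i => by simp [mem_dualLine]) ?_
    intro i j (h : dualLine _ = dualLine _)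
    have hm : ![0, 2 ^ i, 1] ∈ dualLine ![0, 1, -2 ^ j] := h ▸ by simp [mem_dualLine]
    simp [mem_dualLine] at hm
    exact two_pow_real_injective (by simp only; linarith)
  · refine isPencil_image_dualLine (fun h => by simpa using congrFun h 2) _
      (fun i h => by simpa using congrFun h 1) (fun i => by simp [mem_dualLine]) ?_
    intro i j (h : dualLine _ = dualLine _)
    have hm : ![1, 2 ^ i, 0] ∈ dualLine ![-2 ^ j, 1, 0] := h ▸ by simp [mem_dualLine]
    simp [mem_dualLine] at hm
    exact two_pow_real_injective (by simp only; linarith)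
  · exact span_singleton_ne_of_notMem (a := ![0, 1, 0]) (by simp [mem_dualLine])
      (by simp [mem_dualLine])
  · exact span_singleton_ne_of_notMem (a := ![0, 1, 0]) (by simp [mem_dualLine])
      (by simp [mem_dualLine])
  · exact span_singleton_ne_of_notMem (a := ![1, 0, 0]) (by simp [mem_dualLine])
      (by simp [mem_dualLine])
  · set R := RichPoints3 _ _ _ with hR
    have hfin : R.Finite := by
      refine ((Finset.range n ×ˢ Finset.range n).image fun ij : ℕ × ℕ =>
        Submodule.span ℝ {![(2 : ℝ) ^ ij.1, 2 ^ ij.2, 1]}).finite_toSet.subset ?_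
      rintro q ⟨hq, ⟨l₁, hl₁, h₁⟩, ⟨l₂, hl₂, h₂⟩, -⟩
      obtain ⟨i, hi, rfl⟩ := Finset.mem_image.1 hl₁
      obtain ⟨j, hj, rfl⟩ := Finset.mem_image.1 hl₂
      exact Finset.mem_coe.2 (Finset.mem_image.2
        ⟨(i, j), Finset.mk_mem_product hi hj, (eq_span_affine_point hq h₁ h₂).symm⟩)
    set m := (n + 1) / 2 with hm
    let f : ℕ × ℕ → Submodule ℝ (Fin 3 → ℝ) := fun ik =>
      Submodule.span ℝ {![(2 : ℝ) ^ ik.1, 2 ^ (ik.1 + ik.2), 1]}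
    have hf : Function.Injective f := by
      rintro ⟨i, k⟩ ⟨i', k'⟩ h
      obtain ⟨h0, h1⟩ := span_affine_point_inj h
      have e0 : i = i' := two_pow_real_injective h0
      have e1 : i + k = i' + k' := two_pow_real_injective h1
      simp only [Prod.mk.injEq]
      omega
    have hsub : (((Finset.range m ×ˢ Finset.range m).image f : Finset _) : Set _) ⊆ R := by
      intro q hq
      obtain ⟨⟨i, k⟩, hik, rfl⟩ := Finset.mem_image.1 (Finset.mem_coe.1 hq)
      simp only [Finset.mem_product, Finset.mem_range] at hik
      refine ⟨isProjPoint_span_singleton fun h => by simpa using congrFun h 2,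
        ⟨_, Finset.mem_image_of_mem _ (Finset.mem_range.2 (by omega : i < n)), ?_⟩,
        ⟨_, Finset.mem_image_of_mem _ (Finset.mem_range.2 (by omega : i + k < n)), ?_⟩,
        ⟨_, Finset.mem_image_of_mem _ (Finset.mem_range.2 (by omega : k < n)), ?_⟩⟩ <;>
      · rw [Submodule.span_singleton_le_iff_mem, mem_dualLine]
        simp [pow_add]
        try ring
    have hcard : m * m ≤ R.ncard := by
      have h := Set.ncard_le_ncard hsub hfin
      rwa [Set.ncard_coe_finset, Finset.card_image_of_injective _ hf, Finset.card_product,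
        Finset.card_range] at h
    have hcard' : (m : ℝ) * m ≤ R.ncard := by exact_mod_cast hcard
    have hnm : (n : ℝ) ≤ 2 * m := by exact_mod_cast (by omega : n ≤ 2 * m)
    nlinarith [(Nat.cast_nonneg n : (0 : ℝ) ≤ n)]
end

section
/- For every positive integer n there exist four pencils of lines in the real projective plane, each pencil containing at most 2n lines, whose four centres are pairwise distinct and all lie on a common line, such that the pencils determine at least n² 4-rich points. -/
/-- A pencil with centre `p`: a finite set of distinct projective lines all through `p`. -/
def IsPencilSet (p : Submodule ℝ (Fin 3 → ℝ))
    (L : Finset (Submodule ℝ (Fin 3 → ℝ))) : Prop :=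
  IsProjPoint p ∧ ∀ l ∈ L, IsProjLine l ∧ p ≤ l

/-- The set of 4-rich points of four pencils: points lying on one line from each pencil. -/
def RichPoints4 (L₁ L₂ L₃ L₄ : Finset (Submodule ℝ (Fin 3 → ℝ))) :
    Set (Submodule ℝ (Fin 3 → ℝ)) :=
  {q | IsProjPoint q ∧ (∃ l ∈ L₁, q ≤ l) ∧ (∃ l ∈ L₂, q ≤ l) ∧
    (∃ l ∈ L₃, q ≤ l) ∧ (∃ l ∈ L₄, q ≤ l)}

/-- The point with homogeneous coordinates `(x : y : z)`. -/
def projPoint (x y z : ℝ) : Submodule ℝ (Fin 3 → ℝ) := Submodule.span ℝ {![x, y, z]}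

/-- The line with equation `a x + b y + c z = 0`. -/
def projLine (a b c : ℝ) : Submodule ℝ (Fin 3 → ℝ) :=
  LinearMap.ker (a • LinearMap.proj 0 + b • LinearMap.proj 1 + c • LinearMap.proj 2 :
    Module.Dual ℝ (Fin 3 → ℝ))

theorem mem_projLine {a b c : ℝ} {v : Fin 3 → ℝ} :
    v ∈ projLine a b c ↔ a * v 0 + b * v 1 + c * v 2 = 0 := by
  simp [projLine]

theorem projPoint_le_projLine {x y z a b c : ℝ} :
    projPoint x y z ≤ projLine a b c ↔ a * x + b * y + c * z = 0 := by
  simp [projPoint, Submodule.span_singleton_le_iff_mem, mem_projLine]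

theorem isProjPoint_projPoint {x y z : ℝ} (h : ![x, y, z] ≠ 0) :
    IsProjPoint (projPoint x y z) :=
  finrank_span_singleton h

theorem isProjLine_projLine {a b c : ℝ} (h : ![a, b, c] ≠ 0) :
    IsProjLine (projLine a b c) := by
  have hne : (a • LinearMap.proj 0 + b • LinearMap.proj 1 + c • LinearMap.proj 2 :
      Module.Dual ℝ (Fin 3 → ℝ)) ≠ 0 := by
    intro h0
    apply h
    ext i
    have := congrArg (fun f => f (Pi.single i 1)) h0
    fin_cases i <;> simpa using this
  have := Module.Dual.finrank_ker_add_one_of_ne_zero hne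
  rw [Module.finrank_fin_fun] at this
  unfold IsProjLine projLine
  omega

theorem exists_smul_eq_of_projPoint_eq {x y z x' y' z' : ℝ}
    (h : projPoint x y z = projPoint x' y' z') :
    ∃ t : ℝ, t * x' = x ∧ t * y' = y ∧ t * z' = z := by
  have hm : ![x, y, z] ∈ projPoint x' y' z' := h ▸ Submodule.mem_span_singleton_self _
  obtain ⟨t, ht⟩ := Submodule.mem_span_singleton.mp hm
  exact ⟨t, by simpa using congrFun ht 0, by simpa using congrFun ht 1,
    by simpa using congrFun ht 2⟩

theorem eq_projPoint_of_le {q : Submodule ℝ (Fin 3 → ℝ)} (hq : IsProjPoint q) {a b : ℝ}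
    (h₁ : q ≤ projLine 1 0 (-a)) (h₂ : q ≤ projLine 0 1 (-b)) : q = projPoint a b 1 := by
  have hle : q ≤ projPoint a b 1 := by
    intro v hv
    have e₁ := mem_projLine.mp (h₁ hv)
    have e₂ := mem_projLine.mp (h₂ hv)
    refine Submodule.mem_span_singleton.mpr ⟨v 2, ?_⟩
    ext i
    fin_cases i <;> simp <;> linarith
  refine Submodule.eq_of_le_of_finrank_eq hle ?_
  exact hq.trans (isProjPoint_projPoint (by simp)).symm

open Classical in
/-- The pencil of the lines `a x + b y = (k + s) z` for `k < m`. -/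
noncomputable def parallelPencil (a b s : ℝ) (m : ℕ) : Finset (Submodule ℝ (Fin 3 → ℝ)) :=
  (Finset.range m).image fun k : ℕ => projLine a b (-(k + s))

theorem mem_parallelPencil {a b s : ℝ} {m : ℕ} {l : Submodule ℝ (Fin 3 → ℝ)} :
    l ∈ parallelPencil a b s m ↔ ∃ k < m, projLine a b (-(k + s)) = l := by
  simp [parallelPencil]

theorem card_parallelPencil_le (a b s : ℝ) (m : ℕ) : (parallelPencil a b s m).card ≤ m :=
  Finset.card_image_le.trans_eq (Finset.card_range m)

theorem isPencilSet_parallelPencil {a b : ℝ} (s : ℝ) (m : ℕ) (h : a ≠ 0 ∨ b ≠ 0) :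
    IsPencilSet (projPoint (-b) a 0) (parallelPencil a b s m) := by
  refine ⟨isProjPoint_projPoint ?_, fun l hl => ?_⟩
  · rcases h with h | h <;> simp [h]
  · obtain ⟨k, -, rfl⟩ := mem_parallelPencil.mp hl
    refine ⟨isProjLine_projLine ?_, projPoint_le_projLine.mpr (by ring)⟩
    rcases h with h | h <;> simp [h]

theorem richPoints4_parallelPencil (n : ℕ) :
    RichPoints4 (parallelPencil 1 0 0 n) (parallelPencil 0 1 0 n)
      (parallelPencil 1 1 0 (2 * n)) (parallelPencil 1 (-1) (-n) (2 * n)) =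
    (fun p : ℕ × ℕ => projPoint p.1 p.2 1) '' (Finset.range n ×ˢ Finset.range n : Finset _) := by
  ext q
  constructor
  · rintro ⟨hq, ⟨l, hl, hql⟩, ⟨l', hl', hql'⟩, -⟩
    obtain ⟨i, hi, rfl⟩ := mem_parallelPencil.mp hl
    obtain ⟨j, hj, rfl⟩ := mem_parallelPencil.mp hl'
    rw [add_zero] at hql hql'
    exact ⟨(i, j), by simp [hi, hj], (eq_projPoint_of_le hq hql hql').symm⟩
  · rintro ⟨⟨i, j⟩, hij, rfl⟩
    obtain ⟨hi, hj⟩ : i < n ∧ j < n := by simpa using hij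
    refine ⟨isProjPoint_projPoint (by simp),
      ⟨_, mem_parallelPencil.mpr ⟨i, hi, rfl⟩, projPoint_le_projLine.mpr (by simp)⟩,
      ⟨_, mem_parallelPencil.mpr ⟨j, hj, rfl⟩, projPoint_le_projLine.mpr (by simp)⟩,
      ⟨_, mem_parallelPencil.mpr ⟨i + j, by omega, rfl⟩, projPoint_le_projLine.mpr ?_⟩,
      ⟨_, mem_parallelPencil.mpr ⟨i + (n - j), by omega, rfl⟩, projPoint_le_projLine.mpr ?_⟩⟩
    · push_cast
      ring
    · push_cast [hj.le]
      ring

theorem injective_projPoint_natCast :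
    Function.Injective fun p : ℕ × ℕ => projPoint p.1 p.2 1 := by
  rintro ⟨i, j⟩ ⟨i', j'⟩ h
  obtain ⟨t, h₁, h₂, h₃⟩ := exists_smul_eq_of_projPoint_eq h
  obtain rfl : t = 1 := by simpa using h₃
  simp only [one_mul, Nat.cast_inj] at h₁ h₂
  rw [h₁, h₂]

theorem collinear_centres_quadratic_construction :
    ∀ n : ℕ, 0 < n →
      ∃ (p₁ p₂ p₃ p₄ : Submodule ℝ (Fin 3 → ℝ))
        (L₁ L₂ L₃ L₄ : Finset (Submodule ℝ (Fin 3 → ℝ))),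
        IsPencilSet p₁ L₁ ∧ IsPencilSet p₂ L₂ ∧ IsPencilSet p₃ L₃ ∧ IsPencilSet p₄ L₄ ∧
        L₁.card ≤ 2 * n ∧ L₂.card ≤ 2 * n ∧ L₃.card ≤ 2 * n ∧ L₄.card ≤ 2 * n ∧
        p₁ ≠ p₂ ∧ p₁ ≠ p₃ ∧ p₁ ≠ p₄ ∧ p₂ ≠ p₃ ∧ p₂ ≠ p₄ ∧ p₃ ≠ p₄ ∧
        (∃ l, IsProjLine l ∧ p₁ ≤ l ∧ p₂ ≤ l ∧ p₃ ≤ l ∧ p₄ ≤ l) ∧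
        n ^ 2 ≤ (RichPoints4 L₁ L₂ L₃ L₄).ncard := by
  intro n _
  refine ⟨_, _, _, _, _, _, _, _,
    isPencilSet_parallelPencil (a := 1) (b := 0) 0 n (by simp),
    isPencilSet_parallelPencil (a := 0) (b := 1) 0 n (by simp),
    isPencilSet_parallelPencil (a := 1) (b := 1) 0 (2 * n) (by simp),
    isPencilSet_parallelPencil (a := 1) (b := -1) (-n) (2 * n) (by simp),
    (card_parallelPencil_le ..).trans (by omega), (card_parallelPencil_le ..).trans (by omega),
    card_parallelPencil_le .., card_parallelPencil_le ..,
    ?_, ?_, ?_, ?_, ?_, ?_, ⟨projLine 0 0 1, isProjLine_projLine (by simp), ?_, ?_, ?_, ?_⟩, ?_⟩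
  iterate 6
    · intro h
      obtain ⟨t, h₁, h₂, -⟩ := exists_smul_eq_of_projPoint_eq h
      linarith
  iterate 4 exact projPoint_le_projLine.mpr (by ring)
  rw [richPoints4_parallelPencil, Set.ncard_image_of_injective _ injective_projPoint_natCast,
    Set.ncard_coe_finset, Finset.card_product, Finset.card_range, sq]
end
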